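/- Every Dirichlet eigenvalue of the hemisphere, written in the stereographic chart, is of the form n(n+1) for a positive integer n: if f : ℝ² → ℝ is continuous on the closed disc {(u,v) : u² + v² ≤ 4}, twice continuously differentiable on the open disc {(u,v) : u² + v² < 4}, vanishes at every point of the circle {(u,v) : u² + v² = 4}, is not identically zero on the open disc, and satisfies ∂²f/∂u² + ∂²f/∂v² = −λ·(4/(u² + v² + 4))²·f(u,v) at every point of the open disc, then λ = n(n+1) for some positive integer n. -/

import Mathlib

/-- The planar Laplacian `∂²f/∂u² + ∂²f/∂v²` of `f : ℝ × ℝ → ℝ` at a point `q`. -/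
noncomputable def lap2 (f : ℝ × ℝ → ℝ) (q : ℝ × ℝ) : ℝ :=
  deriv (deriv fun u => f (u, q.2)) q.1 + deriv (deriv fun v => f (q.1, v)) q.2

open MeasureTheory Set Filter Topology
/-- angular uniqueness -/
lemma aux_fourier (g : ℝ → ℝ) (hg : Continuous g) (hp : Function.Periodic g (2 * Real.pi))
    (hc : ∀ k : ℕ, ∫ θ in (0:ℝ)..(2 * Real.pi), g θ * Real.cos (k * θ) = 0)
    (hs : ∀ k : ℕ, ∫ θ in (0:ℝ)..(2 * Real.pi), g θ * Real.sin (k * θ) = 0) (θ : ℝ) : g θ = 0 := by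
  have : Fact (0 < 2 * Real.pi) := ⟨Real.two_pi_pos⟩
  have hp' : Function.Periodic (fun θ => (g θ : ℂ)) (2 * Real.pi) := fun x => by simp [hp x]
  let G : C(AddCircle (2 * Real.pi), ℂ) := ⟨hp'.lift, by
    apply continuous_coinduced_dom.mpr
    exact (Complex.continuous_ofReal.comp hg)⟩
  have hcoe : ∀ x : ℝ, G (x : AddCircle (2 * Real.pi)) = (g x : ℂ) := fun x => hp'.lift_coe x
  have hcz : ∀ k : ℤ, ∫ θ in (0:ℝ)..(2 * Real.pi), g θ * Real.cos (k * θ) = 0 := by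
    intro k
    obtain ⟨n, rfl | rfl⟩ := k.eq_nat_or_neg
    · simpa using hc n
    · simpa using hc n
  have hsz : ∀ k : ℤ, ∫ θ in (0:ℝ)..(2 * Real.pi), g θ * Real.sin (k * θ) = 0 := by
    intro k
    obtain ⟨n, rfl | rfl⟩ := k.eq_nat_or_neg
    · simpa using hs n
    · simpa using hs n
  have hz : ∀ n : ℤ, fourierCoeff G n = 0 := by
    intro n
    rw [fourierCoeff_eq_intervalIntegral _ n 0]
    have : ∀ x : ℝ, fourier (-n) (x : AddCircle (2 * Real.pi)) • G (x : AddCircle (2 * Real.pi))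
        = ((g x * Real.cos (n * x) : ℝ) : ℂ) - Complex.I * ((g x * Real.sin (n * x) : ℝ) : ℂ) := by
      intro x
      rw [hcoe, fourier_coe_apply]
      have : (2 * (Real.pi:ℂ) * Complex.I * ((-n : ℤ) : ℂ) * (x:ℂ) / ((2 * Real.pi : ℝ) : ℂ)) = (-(n * x : ℝ) : ℝ) * Complex.I := by
        have : (Real.pi : ℂ) ≠ 0 := by exact_mod_cast Real.pi_ne_zero
        push_cast
        field_simp
      rw [this, Complex.exp_mul_I, ← Complex.ofReal_cos, ← Complex.ofReal_sin, Real.cos_neg, Real.sin_neg]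
      push_cast
      simp only [smul_eq_mul]
      ring
    simp_rw [this]
    rw [intervalIntegral.integral_sub, intervalIntegral.integral_const_mul, intervalIntegral.integral_ofReal,
      intervalIntegral.integral_ofReal]
    · simp only [zero_add]
      rw [hcz, hsz]; simp
    · apply Continuous.intervalIntegrable; fun_prop
    · apply Continuous.intervalIntegrable; fun_prop
  have hsum : Summable (fourierCoeff G) := by
    have : fourierCoeff G = fun _ => 0 := funext hz
    rw [this]; exact summable_zero
  have := has_pointwise_sum_fourier_series_of_summable hsum (θ : AddCircle (2 * Real.pi))
  simp only [hz, zero_smul] at this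
  have h0 := this.unique hasSum_zero
  rw [hcoe] at h0
  exact_mod_cast h0

lemma aux_diff (F F' : ℝ → ℝ → ℝ)
    (hF : ContinuousOn (fun p : ℝ × ℝ => F p.1 p.2) (Ioo (-2) 2 ×ˢ univ))
    (hF' : ContinuousOn (fun p : ℝ × ℝ => F' p.1 p.2) (Ioo (-2) 2 ×ˢ univ))
    (hd : ∀ r ∈ Ioo (-2:ℝ) 2, ∀ θ, HasDerivAt (fun r => F r θ) (F' r θ) r) (a b : ℝ)
    (r : ℝ) (hr : r ∈ Ioo (-2:ℝ) 2) :
    HasDerivAt (fun r => ∫ θ in a..b, F r θ) (∫ θ in a..b, F' r θ) r := by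
  obtain ⟨δ, hδ, hsub⟩ := Metric.nhds_basis_closedBall.mem_iff.1 (Ioo_mem_nhds hr.1 hr.2)
  have hK : IsCompact (Metric.closedBall r δ ×ˢ uIcc a b) :=
    (isCompact_closedBall r δ).prod isCompact_uIcc
  obtain ⟨C, hC⟩ := hK.exists_bound_of_continuousOn
    (hF'.mono (prod_mono hsub (subset_univ _)))
  have hcF : ∀ x ∈ Ioo (-2:ℝ) 2, Continuous (F x) := fun x hx =>
    hF.comp_continuous (f := fun θ : ℝ => (x, θ)) (by fun_prop) (fun θ => ⟨hx, mem_univ _⟩)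
  have hcF' : ∀ x ∈ Ioo (-2:ℝ) 2, Continuous (F' x) := fun x hx =>
    hF'.comp_continuous (f := fun θ : ℝ => (x, θ)) (by fun_prop) (fun θ => ⟨hx, mem_univ _⟩)
  refine (intervalIntegral.hasDerivAt_integral_of_dominated_loc_of_deriv_le (bound := fun _ => C)
    (s := Metric.closedBall r δ) (Metric.closedBall_mem_nhds r hδ) ?_ ?_ ?_ ?_ ?_ ?_).2
  · filter_upwards [Ioo_mem_nhds hr.1 hr.2] with x hx
    exact (hcF x hx).aestronglyMeasurable
  · exact (hcF r hr).intervalIntegrable _ _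
  · exact (hcF' r hr).aestronglyMeasurable
  · refine Eventually.of_forall fun θ hθ x hx => hC (x, θ) ⟨hx, uIoc_subset_uIcc hθ⟩
  · exact intervalIntegrable_const
  · exact Eventually.of_forall fun θ hθ x hx => hd x (hsub hx) θ

noncomputable def rho (r : ℝ) : ℝ := 4 / (r ^ 2 + 4)
noncomputable def SS (r : ℝ) : ℝ := 4 * r / (r ^ 2 + 4)
noncomputable def XX (r : ℝ) : ℝ := (4 - r ^ 2) / (r ^ 2 + 4)

lemma den_pos (r : ℝ) : 0 < r ^ 2 + 4 := by positivity
lemma rho_cont : Continuous rho := by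
  unfold rho; exact continuous_const.div (by fun_prop) (fun r => (den_pos r).ne')
lemma SS_cont : Continuous SS := by
  unfold SS; exact Continuous.div (by fun_prop) (by fun_prop) (fun r => (den_pos r).ne')
lemma XX_cont : Continuous XX := by
  unfold XX; exact Continuous.div (by fun_prop) (by fun_prop) (fun r => (den_pos r).ne')
lemma SS_eq (r : ℝ) : SS r = r * rho r := by unfold SS rho; ring
lemma SX (r : ℝ) : SS r ^ 2 + XX r ^ 2 = 1 := by
  have := (den_pos r).ne'
  unfold SS XX; field_simp; ring
lemma SS_deriv (r : ℝ) : HasDerivAt SS (rho r * XX r) r := by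
  have := (den_pos r).ne'
  have h := ((hasDerivAt_id r).const_mul 4).div (((hasDerivAt_id r).pow 2).add_const 4) this
  refine h.congr_deriv ?_
  unfold rho XX; simp; field_simp; ring
lemma XX_deriv (r : ℝ) : HasDerivAt XX (- (rho r * SS r)) r := by
  have := (den_pos r).ne'
  have h := (((hasDerivAt_id r).pow 2).const_sub 4).div (((hasDerivAt_id r).pow 2).add_const 4) this
  refine h.congr_deriv ?_
  unfold rho SS; simp; field_simp; ring

/-- the derivative of the Wronskian, `m = l + 1` -/
lemma wronsk (k l : ℕ) (lam : ℝ) (φ ψ : ℝ → ℝ) (r : ℝ) (hr : 0 < r)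
    (hd : HasDerivAt φ (ψ r) r)
    (hd2 : HasDerivAt (fun r => r * ψ r) (((k:ℝ) ^ 2 / r - lam * r * rho r ^ 2) * φ r) r) :
    HasDerivAt (fun r => r * ψ r * (SS r ^ k * XX r ^ (l + 1)) -
      φ r * (k * SS r ^ k * XX r ^ (l + 2) - (l + 1 : ℕ) * SS r ^ (k + 2) * XX r ^ l))
      (r * rho r ^ 2 * φ r * ((((k + l + 1 : ℕ) : ℝ) * ((k + l + 1 : ℕ) + 1) - lam)
        * (SS r ^ k * XX r ^ (l + 1)) - (l + 1) * l * (SS r ^ k * XX r ^ (l - 1)))) r := by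
  have hS := SS_deriv r
  have hX := XX_deriv r
  have h := (hd2.mul ((hS.pow k).mul (hX.pow (l + 1)))).sub
    (hd.mul ((((hS.pow k).const_mul (k:ℝ)).mul (hX.pow (l + 2))).sub
      (((hS.pow (k + 2)).const_mul ((l + 1 : ℕ) : ℝ)).mul (hX.pow l))))
  refine h.congr_deriv ?_
  have hrho : rho r = SS r / r := by rw [SS_eq]; field_simp
  have hsx : SS r ^ 2 = 1 - XX r ^ 2 := by linarith [SX r]
  simp only [Pi.mul_apply, Pi.pow_apply, Pi.sub_apply]
  rw [hrho]
  generalize SS r = S at *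
  generalize XX r = X at *
  generalize φ r = p at *
  generalize ψ r = q at *
  have hk : (k:ℝ) * S ^ (k - 1) * S = k * S ^ k := by
    rcases k with _ | k
    · simp
    · simp [pow_succ]; ring
  have hk' : (k:ℝ) * S ^ (k - 1) * (S / r * X) = k * S ^ k * X / r := by
    rw [← hk]; ring
  have hl' : (l:ℝ) * X ^ (l - 1) * X = l * X ^ l := by
    rcases l with _ | l
    · simp
    · simp [pow_succ]; ring
  rw [hk']
  simp only [Nat.add_sub_cancel, show l + 2 - 1 = l + 1 by omega, show k + 2 - 1 = k + 1 by omega]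
  push_cast
  rcases l with _ | l
  · simp only [pow_succ, pow_zero] at *
    field_simp
    push_cast
    linear_combination (-(S ^ k * k ^ 2 * p * X)) * hsx
  · simp only [Nat.add_sub_cancel, pow_succ] at *
    field_simp
    push_cast
    linear_combination (-(S ^ k * X ^ (l + 2) * k ^ 2 * p) - S ^ 2 * S ^ k * X ^ l * p * (l ^ 2 + 3 * l + 2)) * hsx

/-- boundedness of the flux near the outer boundary -/
lemma flux_bdd (k : ℕ) (lam : ℝ) (φ ψ : ℝ → ℝ) (hφc : ContinuousOn φ (Icc 0 2))
    (hd2 : ∀ r ∈ Ioo (0:ℝ) 2, HasDerivAt (fun r => r * ψ r)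
      (((k:ℝ) ^ 2 / r - lam * r * rho r ^ 2) * φ r) r) :
    ∃ C, ∀ r ∈ Ico (1:ℝ) 2, |r * ψ r| ≤ C := by
  have hcont : ContinuousOn (fun r => ((k:ℝ) ^ 2 / r - lam * r * rho r ^ 2) * φ r) (Icc 1 2) := by
    refine ContinuousOn.mul (ContinuousOn.sub ?_ ?_) (hφc.mono (Icc_subset_Icc (by norm_num) le_rfl))
    · exact continuousOn_const.div continuousOn_id (fun x hx => by
        have : (1:ℝ) ≤ x := hx.1
        simp; linarith)
    · have := rho_cont
      fun_prop
  obtain ⟨C, hC⟩ := isCompact_Icc.exists_bound_of_continuousOn hcont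
  refine ⟨|1 * ψ 1| + C * 1, fun r hr => ?_⟩
  have hC0 : 0 ≤ C := (norm_nonneg _).trans (hC 1 (by norm_num))
  have := (convex_Ico (1:ℝ) 2).norm_image_sub_le_of_norm_hasDerivWithin_le
    (f := fun r => r * ψ r) (fun x hx => (hd2 x ⟨by linarith [hx.1], hx.2⟩).hasDerivWithinAt)
    (fun x hx => hC x ⟨hx.1, hx.2.le⟩) (show (1:ℝ) ∈ Ico (1:ℝ) 2 by norm_num) hr
  have h2 : ‖r - 1‖ ≤ 1 := by
    rw [Real.norm_eq_abs, abs_le]; constructor <;> linarith [hr.1, hr.2]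
  have h3 : C * ‖r - 1‖ ≤ C * 1 := mul_le_mul_of_nonneg_left h2 hC0
  have h4 := abs_sub_abs_le_abs_sub (r * ψ r) (1 * ψ 1)
  rw [Real.norm_eq_abs] at this
  linarith

lemma moment_rec (k l : ℕ) (lam : ℝ) (φ ψ : ℝ → ℝ) (hφc : ContinuousOn φ (Icc 0 2))
    (hφ2 : φ 2 = 0) (hψ : ContinuousOn ψ (Ico 0 2))
    (hd : ∀ r ∈ Ioo (0:ℝ) 2, HasDerivAt φ (ψ r) r)
    (hd2 : ∀ r ∈ Ioo (0:ℝ) 2, HasDerivAt (fun r => r * ψ r)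
      (((k:ℝ) ^ 2 / r - lam * r * rho r ^ 2) * φ r) r) :
    (((k + l + 1 : ℕ) : ℝ) * ((k + l + 1 : ℕ) + 1) - lam)
      * ∫ r in (0:ℝ)..2, r * rho r ^ 2 * φ r * (SS r ^ k * XX r ^ (l + 1)) =
      (l + 1) * l * ∫ r in (0:ℝ)..2, r * rho r ^ 2 * φ r * (SS r ^ k * XX r ^ (l - 1)) := by
  have cr := rho_cont
  have cs := SS_cont
  have cx := XX_cont
  have hint : ∀ j : ℕ, IntervalIntegrable (fun r => r * rho r ^ 2 * φ r * (SS r ^ k * XX r ^ j))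
      volume 0 2 := by
    intro j
    apply ContinuousOn.intervalIntegrable
    rw [uIcc_of_le (by norm_num)]
    fun_prop
  have e : ∀ r, r * rho r ^ 2 * φ r * ((((k + l + 1 : ℕ) : ℝ) * ((k + l + 1 : ℕ) + 1) - lam)
        * (SS r ^ k * XX r ^ (l + 1)) - (l + 1) * l * (SS r ^ k * XX r ^ (l - 1))) =
      (((k + l + 1 : ℕ) : ℝ) * ((k + l + 1 : ℕ) + 1) - lam) *
        (r * rho r ^ 2 * φ r * (SS r ^ k * XX r ^ (l + 1))) -
        (l + 1) * l * (r * rho r ^ 2 * φ r * (SS r ^ k * XX r ^ (l - 1))) := by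
    intro r; ring
  have t0 : Tendsto φ (𝓝[>] 0) (𝓝 (φ 0)) :=
    ((hφc 0 (by norm_num)).mono_of_mem_nhdsWithin
      (mem_of_superset (Ioo_mem_nhdsGT (show (0:ℝ) < 2 by norm_num)) Ioo_subset_Icc_self))
  have t2 : Tendsto φ (𝓝[<] 2) (𝓝 0) := hφ2 ▸
    ((hφc 2 (by norm_num)).mono_of_mem_nhdsWithin
      (mem_of_superset (Ioo_mem_nhdsLT (show (0:ℝ) < 2 by norm_num)) Ioo_subset_Icc_self))
  have s0 : Tendsto ψ (𝓝[>] 0) (𝓝 (ψ 0)) :=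
    ((hψ 0 (by norm_num)).mono_of_mem_nhdsWithin
      (mem_of_superset (Ioo_mem_nhdsGT (show (0:ℝ) < 2 by norm_num)) Ioo_subset_Ico_self))
  have S0 : SS 0 = 0 := by simp [SS]
  have X2 : XX 2 = 0 := by norm_num [XX]
  obtain ⟨C, hC⟩ := flux_bdd k lam φ ψ hφc hd2
  have key := intervalIntegral.integral_eq_sub_of_hasDerivAt_of_tendsto (a := 0) (b := 2)
    (fa := 0) (fb := 0) (by norm_num)
    (fun r hr => wronsk k l lam φ ψ r hr.1 (hd r hr) (hd2 r hr)) ?_ ?_ ?_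
  · simp_rw [e] at key
    rw [intervalIntegral.integral_sub ((hint _).const_mul _) ((hint _).const_mul _),
      intervalIntegral.integral_const_mul, intervalIntegral.integral_const_mul] at key
    linarith
  · simp_rw [e]
    exact ((hint _).const_mul _).sub ((hint _).const_mul _)
  · have c1 : Tendsto (fun r => r * (SS r ^ k * XX r ^ (l + 1))) (𝓝[>] 0) (𝓝 0) := by
      have : Continuous (fun r => r * (SS r ^ k * XX r ^ (l + 1))) := by fun_prop
      have := this.tendsto 0
      simp only [zero_mul] at this
      exact this.mono_left nhdsWithin_le_nhds
    have c2 : Tendsto (fun r => (k * SS r ^ k * XX r ^ (l + 2) - (l + 1 : ℕ) * SS r ^ (k + 2) * XX r ^ l)) (𝓝[>] 0) (𝓝 0) := by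
      have : Continuous (fun r => (k * SS r ^ k * XX r ^ (l + 2) - (l + 1 : ℕ) * SS r ^ (k + 2) * XX r ^ l)) := by fun_prop
      have := this.tendsto 0
      have h0 : (k:ℝ) * 0 ^ k = 0 := by rcases k with _ | k <;> simp
      simp only [S0, h0] at this
      simp only [zero_mul, ne_eq, Nat.add_eq_zero_iff, OfNat.ofNat_ne_zero, and_false, not_false_eq_true, zero_pow, mul_zero, sub_zero] at this
      exact this.mono_left nhdsWithin_le_nhds
    have := (s0.mul c1).sub (t0.mul c2)
    simp only [mul_zero, sub_zero] at this
    refine this.congr fun r => ?_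
    ring
  · have c1 : Tendsto (fun r => (SS r ^ k * XX r ^ (l + 1))) (𝓝[<] 2) (𝓝 0) := by
      have : Continuous (fun r => (SS r ^ k * XX r ^ (l + 1))) := by fun_prop
      have := this.tendsto 2
      simp only [X2, ne_eq, Nat.add_eq_zero_iff, one_ne_zero, and_false, not_false_eq_true, zero_pow, mul_zero] at this
      exact this.mono_left nhdsWithin_le_nhds
    have c2 : Tendsto (fun r => (k * SS r ^ k * XX r ^ (l + 2) - (l + 1 : ℕ) * SS r ^ (k + 2) * XX r ^ l)) (𝓝[<] 2)
        (𝓝 (k * SS 2 ^ k * XX 2 ^ (l + 2) - (l + 1 : ℕ) * SS 2 ^ (k + 2) * XX 2 ^ l)) := by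
      have : Continuous (fun r => (k * SS r ^ k * XX r ^ (l + 2) - (l + 1 : ℕ) * SS r ^ (k + 2) * XX r ^ l)) := by fun_prop
      exact (this.tendsto 2).mono_left nhdsWithin_le_nhds
    have hb : Tendsto (fun r => r * ψ r * (SS r ^ k * XX r ^ (l + 1))) (𝓝[<] 2) (𝓝 0) := by
      have c3 : Tendsto (fun r => C * |SS r ^ k * XX r ^ (l + 1)|) (𝓝[<] 2) (𝓝 0) := by
        simpa using c1.abs.const_mul C
      refine squeeze_zero_norm' ?_ c3
      filter_upwards [Ioo_mem_nhdsLT (show (1:ℝ) < 2 by norm_num)] with r hr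
      rw [Real.norm_eq_abs, abs_mul]
      exact mul_le_mul_of_nonneg_right (hC r ⟨hr.1.le, hr.2⟩) (abs_nonneg _)
    simpa using hb.sub (t2.mul c2)

lemma moments_zero (k : ℕ) (lam : ℝ) (φ ψ : ℝ → ℝ) (hφc : ContinuousOn φ (Icc 0 2))
    (hφ2 : φ 2 = 0) (hψ : ContinuousOn ψ (Ico 0 2))
    (hd : ∀ r ∈ Ioo (0:ℝ) 2, HasDerivAt φ (ψ r) r)
    (hd2 : ∀ r ∈ Ioo (0:ℝ) 2, HasDerivAt (fun r => r * ψ r)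
      (((k:ℝ) ^ 2 / r - lam * r * rho r ^ 2) * φ r) r)
    (hlam : ∀ n : ℕ, 1 ≤ n → lam ≠ (n : ℝ) * (n + 1)) (j : ℕ) :
    ∫ r in (0:ℝ)..2, r * rho r ^ 2 * φ r * (SS r ^ k * XX r ^ (2 * j + 1)) = 0 := by
  induction j with
  | zero =>
    have := moment_rec k 0 lam φ ψ hφc hφ2 hψ hd hd2
    simp only [Nat.cast_zero, mul_zero, zero_mul] at this
    rcases mul_eq_zero.1 this with h | h
    · exact absurd (by linarith) (hlam (k + 0 + 1) (by omega))
    · simpa using h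
  | succ j ih =>
    have := moment_rec k (2 * j + 2) lam φ ψ hφc hφ2 hψ hd hd2
    rw [show 2 * j + 2 - 1 = 2 * j + 1 by omega, ih, mul_zero] at this
    rcases mul_eq_zero.1 this with h | h
    · exact absurd (by linarith) (hlam (k + (2 * j + 2) + 1) (by omega))
    · exact h

lemma poly_zero (k : ℕ) (φ : ℝ → ℝ) (hφc : ContinuousOn φ (Icc 0 2))
    (h : ∀ j : ℕ, ∫ r in (0:ℝ)..2, r * rho r ^ 2 * φ r * (SS r ^ k * XX r ^ (2 * j + 1)) = 0)
    (P : Polynomial ℝ) :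
    ∫ r in (0:ℝ)..2, r * rho r ^ 2 * SS r ^ k * XX r * φ r * P.eval (XX r ^ 2) = 0 := by
  have cr := rho_cont
  have cs := SS_cont
  have cx := XX_cont
  simp_rw [Polynomial.eval_eq_sum_range, Finset.mul_sum]
  rw [intervalIntegral.integral_finsetSum]
  · refine Finset.sum_eq_zero fun j _ => ?_
    have := congrArg (fun t => P.coeff j * t) (h j)
    simp only [mul_zero] at this
    rw [← intervalIntegral.integral_const_mul] at this
    rw [← this]
    congr 1; ext r; ring
  · intro j _
    apply ContinuousOn.intervalIntegrable
    rw [uIcc_of_le (by norm_num)]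
    fun_prop

lemma radial_zero (k : ℕ) (φ : ℝ → ℝ) (hφc : ContinuousOn φ (Icc 0 2))
    (h : ∀ P : Polynomial ℝ, ∫ r in (0:ℝ)..2, r * rho r ^ 2 * SS r ^ k * XX r * φ r * P.eval (XX r ^ 2) = 0) :
    ∀ r ∈ Ioo (0:ℝ) 2, φ r = 0 := by
  have cr := rho_cont
  have cs := SS_cont
  have cx := XX_cont
  set w : ℝ → ℝ := fun r => r * rho r ^ 2 * SS r ^ k * XX r with hw
  have cw : Continuous w := by fun_prop
  have hxpos : ∀ r ∈ Icc (0:ℝ) 2, XX r ∈ Icc (0:ℝ) 1 := by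
    intro r hr
    have h4 : r ^ 2 ≤ 4 := by nlinarith [hr.1, hr.2]
    unfold XX
    constructor
    · exact div_nonneg (by linarith) (den_pos r).le
    · rw [div_le_one (den_pos r)]; nlinarith [sq_nonneg r]
  have wpos : ∀ r ∈ Ioo (0:ℝ) 2, 0 < w r := by
    intro r hr
    have h1 : 0 < r := hr.1
    have h2 : 0 < rho r := by unfold rho; positivity
    have h3 : 0 < SS r := by unfold SS; positivity
    have h4 : 0 < XX r := by
      unfold XX
      exact div_pos (by nlinarith [hr.1, hr.2]) (den_pos r)
    simp only [hw]; positivity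
  -- the inverse chart
  let R : ℝ → ℝ := fun z => 2 * Real.sqrt ((1 - Real.sqrt z) / (1 + Real.sqrt z))
  have hR : Continuous R := by
    have : ∀ z : ℝ, 1 + Real.sqrt z ≠ 0 := fun z => by positivity
    have h1 : Continuous fun z : ℝ => (1 - Real.sqrt z) / (1 + Real.sqrt z) :=
      Continuous.div (by fun_prop) (by fun_prop) this
    fun_prop
  have hRm : MapsTo R (Icc 0 1) (Icc 0 2) := by
    intro z hz
    refine ⟨by positivity, ?_⟩
    have h1 : Real.sqrt ((1 - Real.sqrt z) / (1 + Real.sqrt z)) ≤ 1 := by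
      rw [Real.sqrt_le_one, div_le_one (by positivity)]
      linarith [Real.sqrt_nonneg z]
    simp only [R]; linarith
  have hRX : ∀ r ∈ Icc (0:ℝ) 2, R (XX r ^ 2) = r := by
    intro r hr
    simp only [R]
    rw [Real.sqrt_sq (hxpos r hr).1]
    have : (1 - XX r) / (1 + XX r) = (r / 2) ^ 2 := by
      have := (den_pos r).ne'
      unfold XX
      have h8 : 1 + (4 - r ^ 2) / (r ^ 2 + 4) = 8 / (r ^ 2 + 4) := by field_simp; ring
      rw [h8]
      field_simp; ring
    rw [this, Real.sqrt_sq (by linarith [hr.1])]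
    ring
  have hΦ : ContinuousOn (fun z => φ (R z)) (Icc 0 1) := hφc.comp hR.continuousOn hRm
  have cwφ : ContinuousOn (fun r => w r * φ r) (Icc 0 2) := cw.continuousOn.mul hφc
  set M := ∫ r in (0:ℝ)..2, |w r * φ r| with hM
  have hint0 : ContinuousOn (fun r => w r * φ r ^ 2) (Icc 0 2) := by fun_prop
  have hM0 : 0 ≤ M := intervalIntegral.integral_nonneg (by norm_num) fun _ _ => abs_nonneg _
  have hle : ∀ ε > 0, |∫ r in (0:ℝ)..2, w r * φ r ^ 2| ≤ ε * M := by
    intro ε hε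
    obtain ⟨P, hP⟩ := exists_polynomial_near_of_continuousOn 0 1 _ hΦ ε hε
    have e1 : ∫ r in (0:ℝ)..2, w r * φ r ^ 2 =
        ∫ r in (0:ℝ)..2, (w r * φ r ^ 2 - w r * φ r * P.eval (XX r ^ 2)) := by
      rw [intervalIntegral.integral_sub, h P, sub_zero]
      · apply ContinuousOn.intervalIntegrable
        rwa [uIcc_of_le (by norm_num)]
      · apply ContinuousOn.intervalIntegrable
        rw [uIcc_of_le (by norm_num)]
        have : Continuous fun r => P.eval (XX r ^ 2) := P.continuous.comp (by fun_prop)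
        exact cwφ.mul this.continuousOn
    rw [e1, hM, ← intervalIntegral.integral_const_mul, ← Real.norm_eq_abs]
    refine intervalIntegral.norm_integral_le_of_norm_le (by norm_num) ?_ ?_
    · refine Eventually.of_forall fun r hr => ?_
      have hr' : r ∈ Icc (0:ℝ) 2 := ⟨hr.1.le, hr.2⟩
      have hx := hxpos r hr'
      have := hP (XX r ^ 2) ⟨by positivity, by nlinarith [hx.1, hx.2]⟩
      simp only [hRX r hr'] at this
      rw [show w r * φ r ^ 2 - w r * φ r * P.eval (XX r ^ 2) =
        -(P.eval (XX r ^ 2) - φ r) * (w r * φ r) by ring, Real.norm_eq_abs, abs_mul, abs_neg]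
      exact mul_le_mul_of_nonneg_right this.le (abs_nonneg _)
    · apply ContinuousOn.intervalIntegrable
      rw [uIcc_of_le (by norm_num)]
      exact continuousOn_const.mul cwφ.abs
  have hzero : ∫ r in (0:ℝ)..2, w r * φ r ^ 2 = 0 := by
    rw [← abs_eq_zero]
    refine le_antisymm (le_of_forall_pos_le_add fun ε hε => ?_) (abs_nonneg _)
    have := hle (ε / (M + 1)) (by positivity)
    have h2 : ε / (M + 1) * M ≤ ε := by
      rw [div_mul_eq_mul_div, div_le_iff₀ (by positivity)]; nlinarith
    linarith
  intro r hr
  by_contra hne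
  have hpos : 0 < ∫ r in (0:ℝ)..2, w r * φ r ^ 2 := by
    refine intervalIntegral.integral_pos (by norm_num) hint0 (fun x hx => ?_)
      ⟨r, ⟨hr.1.le, hr.2.le⟩, ?_⟩
    · rcases hx.2.lt_or_eq with h2 | h2
      · exact mul_nonneg (wpos x ⟨hx.1, h2⟩).le (sq_nonneg _)
      · have : XX 2 = 0 := by norm_num [XX]
        simp [hw, h2, this]
    · exact mul_pos (wpos r hr) (by positivity)
  linarith

lemma chain2 (g : ℝ × ℝ → ℝ) (x y : ℝ → ℝ) (x' y' t : ℝ) (hg : DifferentiableAt ℝ g (x t, y t))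
    (hx : HasDerivAt x x' t) (hy : HasDerivAt y y' t) :
    HasDerivAt (fun t => g (x t, y t))
      (x' * fderiv ℝ g (x t, y t) (1, 0) + y' * fderiv ℝ g (x t, y t) (0, 1)) t := by
  have h := hg.hasFDerivAt.comp_hasDerivAt t (hx.prodMk hy)
  refine h.congr_deriv ?_
  have : ((x', y') : ℝ × ℝ) = x' • (1, 0) + y' • (0, 1) := by simp
  rw [this, map_add, map_smul, map_smul]
  simp

lemma mode_zero (lam : ℝ) (f : ℝ × ℝ → ℝ)
    (hf_cont : ContinuousOn f {q : ℝ × ℝ | q.1 ^ 2 + q.2 ^ 2 ≤ 4})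
    (hf_smooth : ContDiffOn ℝ 2 f {q : ℝ × ℝ | q.1 ^ 2 + q.2 ^ 2 < 4})
    (hf_bdry : ∀ q : ℝ × ℝ, q.1 ^ 2 + q.2 ^ 2 = 4 → f q = 0)
    (hf_eq : ∀ q : ℝ × ℝ, q.1 ^ 2 + q.2 ^ 2 < 4 →
      lap2 f q = -lam * (4 / (q.1 ^ 2 + q.2 ^ 2 + 4)) ^ 2 * f q)
    (hlam : ∀ n : ℕ, 1 ≤ n → lam ≠ (n : ℝ) * (n + 1))
    (k : ℕ) (c c' : ℝ → ℝ) (hc : ∀ θ, HasDerivAt c (c' θ) θ)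
    (hc' : ∀ θ, HasDerivAt c' (-(k:ℝ) ^ 2 * c θ) θ) (hp : c (2 * Real.pi) = c 0)
    (hp' : c' (2 * Real.pi) = c' 0) :
    ∀ r ∈ Ioo (0:ℝ) 2,
      ∫ θ in (0:ℝ)..(2 * Real.pi), f (r * Real.cos θ, r * Real.sin θ) * c θ = 0 := by
  set D : Set (ℝ × ℝ) := {q : ℝ × ℝ | q.1 ^ 2 + q.2 ^ 2 < 4} with hD
  have hDo : IsOpen D := isOpen_lt (by fun_prop) (by fun_prop)
  have cc : Continuous c := continuous_iff_continuousAt.2 fun θ => (hc θ).continuousAt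
  have cc' : Continuous c' := continuous_iff_continuousAt.2 fun θ => (hc' θ).continuousAt
  have sqP : ∀ r θ : ℝ, (r * Real.cos θ) ^ 2 + (r * Real.sin θ) ^ 2 = r ^ 2 := fun r θ => by
    linear_combination r ^ 2 * Real.sin_sq_add_cos_sq θ
  have hmem : ∀ r ∈ Ioo (-2:ℝ) 2, ∀ θ : ℝ, (r * Real.cos θ, r * Real.sin θ) ∈ D := by
    intro r hr θ
    simp only [hD, mem_ofPred_eq, sqP]
    nlinarith [hr.1, hr.2]
  set fu : ℝ × ℝ → ℝ := fun q => fderiv ℝ f q (1, 0) with hfu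
  set fv : ℝ × ℝ → ℝ := fun q => fderiv ℝ f q (0, 1) with hfv
  have hfd : ContDiffOn ℝ 1 (fderiv ℝ f) D := hf_smooth.fderiv_of_isOpen hDo (by norm_num)
  have hu : ContDiffOn ℝ 1 fu D := hfd.clm_apply contDiffOn_const
  have hv : ContDiffOn ℝ 1 fv D := hfd.clm_apply contDiffOn_const
  have hud : ContinuousOn (fderiv ℝ fu) D := hu.continuousOn_fderiv_of_isOpen hDo le_rfl
  have hvd : ContinuousOn (fderiv ℝ fv) D := hv.continuousOn_fderiv_of_isOpen hDo le_rfl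
  have df : ∀ q ∈ D, DifferentiableAt ℝ f q := fun q hq =>
    (hf_smooth.differentiableOn (by norm_num)).differentiableAt (hDo.mem_nhds hq)
  have du : ∀ q ∈ D, DifferentiableAt ℝ fu q := fun q hq =>
    (hu.differentiableOn (by norm_num)).differentiableAt (hDo.mem_nhds hq)
  have dv : ∀ q ∈ D, DifferentiableAt ℝ fv q := fun q hq =>
    (hv.differentiableOn (by norm_num)).differentiableAt (hDo.mem_nhds hq)
  set fuu : ℝ × ℝ → ℝ := fun q => fderiv ℝ fu q (1, 0) with hfuu
  set fuv : ℝ × ℝ → ℝ := fun q => fderiv ℝ fu q (0, 1) with hfuv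
  set fvu : ℝ × ℝ → ℝ := fun q => fderiv ℝ fv q (1, 0) with hfvu
  set fvv : ℝ × ℝ → ℝ := fun q => fderiv ℝ fv q (0, 1) with hfvv
  have cf : ContinuousOn f D := hf_smooth.continuousOn
  have cu : ContinuousOn fu D := hu.continuousOn
  have cv : ContinuousOn fv D := hv.continuousOn
  have cuu : ContinuousOn fuu D := hud.clm_apply continuousOn_const
  have cuv : ContinuousOn fuv D := hud.clm_apply continuousOn_const
  have cvu : ContinuousOn fvu D := hvd.clm_apply continuousOn_const
  have cvv : ContinuousOn fvv D := hvd.clm_apply continuousOn_const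
  -- Laplacian
  have hlap : ∀ q ∈ D, lap2 f q = fuu q + fvv q := by
    intro q hq
    unfold lap2
    have h1 : deriv (fun u => f (u, q.2)) =ᶠ[𝓝 q.1] fun u => fu (u, q.2) := by
      have : ∀ᶠ u in 𝓝 q.1, (u, q.2) ∈ D :=
        (show Continuous fun u : ℝ => (u, q.2) by fun_prop).continuousAt.eventually_mem
          (hDo.mem_nhds hq)
      filter_upwards [this] with u hu'
      have := chain2 f (fun t => t) (fun _ => q.2) 1 0 u (df _ hu') (hasDerivAt_id u)
        (hasDerivAt_const u _)
      rw [this.deriv]; simp [hfu]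
    have h2 : deriv (fun v => f (q.1, v)) =ᶠ[𝓝 q.2] fun v => fv (q.1, v) := by
      have : ∀ᶠ v in 𝓝 q.2, (q.1, v) ∈ D :=
        (show Continuous fun v : ℝ => (q.1, v) by fun_prop).continuousAt.eventually_mem
          (hDo.mem_nhds hq)
      filter_upwards [this] with v hv'
      have := chain2 f (fun _ => q.1) (fun t => t) 0 1 v (df _ hv') (hasDerivAt_const v _)
        (hasDerivAt_id v)
      rw [this.deriv]; simp [hfv]
    rw [h1.deriv_eq, h2.deriv_eq]
    have h3 := chain2 fu (fun t => t) (fun _ => q.2) 1 0 q.1 (du _ hq) (hasDerivAt_id _)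
        (hasDerivAt_const _ _)
    have h4 := chain2 fv (fun _ => q.1) (fun t => t) 0 1 q.2 (dv _ hq) (hasDerivAt_const _ _)
        (hasDerivAt_id _)
    rw [h3.deriv, h4.deriv]; simp [hfuu, hfvv]
  -- composition with polar coordinates
  let P : ℝ × ℝ → ℝ × ℝ := fun p => (p.1 * Real.cos p.2, p.1 * Real.sin p.2)
  have cP : Continuous P := by fun_prop
  have mP : MapsTo P (Ioo (-2) 2 ×ˢ univ) D := fun p hp => hmem p.1 hp.1 p.2
  have comp : ∀ g : ℝ × ℝ → ℝ, ContinuousOn g D →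
      ContinuousOn (fun p : ℝ × ℝ => g (p.1 * Real.cos p.2, p.1 * Real.sin p.2))
        (Ioo (-2) 2 ×ˢ univ) := fun g hg => hg.comp cP.continuousOn mP
  have compθ : ∀ g : ℝ × ℝ → ℝ, ContinuousOn g D → ∀ r ∈ Ioo (-2:ℝ) 2,
      Continuous (fun θ : ℝ => g (r * Real.cos θ, r * Real.sin θ)) := fun g hg r hr =>
    hg.comp_continuous (by fun_prop) (hmem r hr)
  have compr : ∀ g : ℝ × ℝ → ℝ, (∀ q ∈ D, DifferentiableAt ℝ g q) → ∀ r ∈ Ioo (-2:ℝ) 2, ∀ θ : ℝ,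
      HasDerivAt (fun r => g (r * Real.cos θ, r * Real.sin θ))
        (Real.cos θ * fderiv ℝ g (r * Real.cos θ, r * Real.sin θ) (1, 0)
          + Real.sin θ * fderiv ℝ g (r * Real.cos θ, r * Real.sin θ) (0, 1)) r := by
    intro g hg r hr θ
    exact chain2 g (fun r => r * Real.cos θ) (fun r => r * Real.sin θ) _ _ r (hg _ (hmem r hr θ))
      (by simpa using (hasDerivAt_id r).mul_const (Real.cos θ))
      (by simpa using (hasDerivAt_id r).mul_const (Real.sin θ))
  have compt : ∀ g : ℝ × ℝ → ℝ, (∀ q ∈ D, DifferentiableAt ℝ g q) → ∀ r ∈ Ioo (-2:ℝ) 2, ∀ θ : ℝ,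
      HasDerivAt (fun θ => g (r * Real.cos θ, r * Real.sin θ))
        (r * -Real.sin θ * fderiv ℝ g (r * Real.cos θ, r * Real.sin θ) (1, 0)
          + r * Real.cos θ * fderiv ℝ g (r * Real.cos θ, r * Real.sin θ) (0, 1)) θ := by
    intro g hg r hr θ
    exact chain2 g (fun θ => r * Real.cos θ) (fun θ => r * Real.sin θ) _ _ θ (hg _ (hmem r hr θ))
      ((Real.hasDerivAt_cos θ).const_mul r) ((Real.hasDerivAt_sin θ).const_mul r)
  let F : ℝ → ℝ → ℝ := fun r θ => f (r * Real.cos θ, r * Real.sin θ)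
  let G1 : ℝ → ℝ → ℝ := fun r θ => Real.cos θ * fu (r * Real.cos θ, r * Real.sin θ)
    + Real.sin θ * fv (r * Real.cos θ, r * Real.sin θ)
  let G2 : ℝ → ℝ → ℝ := fun r θ =>
    Real.cos θ * (Real.cos θ * fuu (r * Real.cos θ, r * Real.sin θ)
      + Real.sin θ * fuv (r * Real.cos θ, r * Real.sin θ))
    + Real.sin θ * (Real.cos θ * fvu (r * Real.cos θ, r * Real.sin θ)
      + Real.sin θ * fvv (r * Real.cos θ, r * Real.sin θ))
  have gen1 : ∀ a b : ℝ × ℝ → ℝ, ContinuousOn a (Ioo (-2) 2 ×ˢ univ) →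
      ContinuousOn b (Ioo (-2) 2 ×ˢ univ) → ContinuousOn (fun p : ℝ × ℝ =>
        (Real.cos p.2 * a p + Real.sin p.2 * b p) * c p.2) (Ioo (-2) 2 ×ˢ univ) := by
    intro a b ha hb; fun_prop
  have gen2 : ∀ a b d e : ℝ × ℝ → ℝ, ContinuousOn a (Ioo (-2) 2 ×ˢ univ) →
      ContinuousOn b (Ioo (-2) 2 ×ˢ univ) → ContinuousOn d (Ioo (-2) 2 ×ˢ univ) →
      ContinuousOn e (Ioo (-2) 2 ×ˢ univ) → ContinuousOn (fun p : ℝ × ℝ =>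
        (Real.cos p.2 * (Real.cos p.2 * a p + Real.sin p.2 * b p) +
          Real.sin p.2 * (Real.cos p.2 * d p + Real.sin p.2 * e p)) * c p.2)
        (Ioo (-2) 2 ×ˢ univ) := by
    intro a b d e ha hb hd he; fun_prop
  have gen3 : ∀ a b : ℝ → ℝ, Continuous a → Continuous b → Continuous (fun θ : ℝ =>
        Real.cos θ * a θ + Real.sin θ * b θ) := by
    intro a b ha hb; fun_prop
  have gen4 : ∀ (r : ℝ) (g h a b d e : ℝ → ℝ), Continuous g → Continuous h → Continuous a →
      Continuous b → Continuous d → Continuous e → Continuous (fun θ : ℝ =>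
        (r * -Real.cos θ * g θ + r * -Real.sin θ *
          (r * -Real.sin θ * a θ + r * Real.cos θ * b θ)) +
        (r * -Real.sin θ * h θ + r * Real.cos θ *
          (r * -Real.sin θ * d θ + r * Real.cos θ * e θ))) := by
    intro r g h a b d e hg hh ha hb hd he; fun_prop
  have cF2 := comp f cf
  have cu2 := comp fu cu
  have cv2 := comp fv cv
  have cuu2 := comp fuu cuu
  have cuv2 := comp fuv cuv
  have cvu2 := comp fvu cvu
  have cvv2 := comp fvv cvv
  have g1On : ContinuousOn (fun p : ℝ × ℝ => G1 p.1 p.2 * c p.2) (Ioo (-2) 2 ×ˢ univ) :=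
    gen1 _ _ cu2 cv2
  have g2On : ContinuousOn (fun p : ℝ × ℝ => G2 p.1 p.2 * c p.2) (Ioo (-2) 2 ×ˢ univ) :=
    gen2 _ _ _ _ cuu2 cuv2 cvu2 cvv2
  let φ : ℝ → ℝ := fun r => ∫ θ in (0:ℝ)..(2 * Real.pi), F r θ * c θ
  let ψ : ℝ → ℝ := fun r => ∫ θ in (0:ℝ)..(2 * Real.pi), G1 r θ * c θ
  have hφd : ∀ r ∈ Ioo (-2:ℝ) 2, HasDerivAt φ (ψ r) r := by
    intro r hr
    refine aux_diff (fun r θ => F r θ * c θ) (fun r θ => G1 r θ * c θ) ?_ ?_ ?_ _ _ r hr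
    · exact cF2.mul (cc.comp continuous_snd).continuousOn
    · exact g1On
    · intro r hr θ
      exact (compr f df r hr θ).mul_const _
  have hψd : ∀ r ∈ Ioo (-2:ℝ) 2,
      HasDerivAt ψ (∫ θ in (0:ℝ)..(2 * Real.pi), G2 r θ * c θ) r := by
    intro r hr
    refine aux_diff (fun r θ => G1 r θ * c θ) (fun r θ => G2 r θ * c θ) ?_ ?_ ?_ _ _ r hr
    · exact g1On
    · exact g2On
    · intro r hr θ
      exact (((compr fu du r hr θ).const_mul _).add ((compr fv dv r hr θ).const_mul _)).mul_const _
  have hφc : ContinuousOn φ (Icc 0 2) := by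
    have hcl : Continuous fun p : ℝ × ℝ => f ((max 0 (min p.1 2)) * Real.cos p.2,
        (max 0 (min p.1 2)) * Real.sin p.2) * c p.2 := by
      refine Continuous.mul ?_ (by fun_prop)
      refine hf_cont.comp_continuous (f := fun p : ℝ × ℝ => ((max 0 (min p.1 2)) * Real.cos p.2,
        (max 0 (min p.1 2)) * Real.sin p.2)) (by fun_prop) (fun p => ?_)
      simp only [mem_ofPred_eq, sqP]
      have h1 : 0 ≤ max 0 (min p.1 2) := le_max_left _ _
      have h2 : max 0 (min p.1 2) ≤ 2 := max_le (by norm_num) (min_le_right _ _)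
      nlinarith
    have := intervalIntegral.continuous_parametric_intervalIntegral_of_continuous' (μ := volume)
      (f := fun r θ => f ((max 0 (min r 2)) * Real.cos θ,
        (max 0 (min r 2)) * Real.sin θ) * c θ) hcl 0 (2 * Real.pi)
    refine this.continuousOn.congr fun r hr => ?_
    simp only [φ, F]
    rw [min_eq_left hr.2, max_eq_right hr.1]
  have hφ2 : φ 2 = 0 := by
    simp only [φ, F]
    have : ∀ θ : ℝ, f (2 * Real.cos θ, 2 * Real.sin θ) = 0 := fun θ =>
      hf_bdry _ (by simp only [sqP]; norm_num)
    simp [this]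
  have hψc : ContinuousOn ψ (Ico 0 2) := fun r hr =>
    (hψd r ⟨by linarith [hr.1], hr.2⟩).continuousAt.continuousWithinAt
  have hd2 : ∀ r ∈ Ioo (0:ℝ) 2, HasDerivAt (fun r => r * ψ r)
      (((k:ℝ) ^ 2 / r - lam * r * rho r ^ 2) * φ r) r := by
    intro r hr
    have hr0 : r ≠ 0 := hr.1.ne'
    have hr' : r ∈ Ioo (-2:ℝ) 2 := ⟨by linarith [hr.1], hr.2⟩
    refine ((hasDerivAt_id r).mul (hψd r hr')).congr_deriv ?_
    have k0 := compθ f cf r hr'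
    have k1 := compθ fu cu r hr'
    have k2 := compθ fv cv r hr'
    have k3 := compθ fuu cuu r hr'
    have k4 := compθ fuv cuv r hr'
    have k5 := compθ fvu cvu r hr'
    have k6 := compθ fvv cvv r hr'
    let T1 : ℝ → ℝ := fun θ => r * -Real.sin θ * fu (r * Real.cos θ, r * Real.sin θ)
      + r * Real.cos θ * fv (r * Real.cos θ, r * Real.sin θ)
    let T2 : ℝ → ℝ := fun θ =>
      (r * -Real.cos θ * fu (r * Real.cos θ, r * Real.sin θ) + r * -Real.sin θ *
        (r * -Real.sin θ * fuu (r * Real.cos θ, r * Real.sin θ)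
          + r * Real.cos θ * fuv (r * Real.cos θ, r * Real.sin θ)))
      + (r * -Real.sin θ * fv (r * Real.cos θ, r * Real.sin θ) + r * Real.cos θ *
        (r * -Real.sin θ * fvu (r * Real.cos θ, r * Real.sin θ)
          + r * Real.cos θ * fvv (r * Real.cos θ, r * Real.sin θ)))
    have hFd : ∀ θ, HasDerivAt (F r) (T1 θ) θ := fun θ => compt f df r hr' θ
    have hT1 : ∀ θ, HasDerivAt T1 (T2 θ) θ := fun θ =>
      ((((Real.hasDerivAt_sin θ).neg).const_mul r).mul (compt fu du r hr' θ)).add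
      (((Real.hasDerivAt_cos θ).const_mul r).mul (compt fv dv r hr' θ))
    have cT2 : Continuous T2 := gen4 r _ _ _ _ _ _ k1 k2 k3 k4 k5 k6
    have cFr : Continuous (F r) := k0
    have ibp : ∫ θ in (0:ℝ)..(2 * Real.pi), (T2 θ * c θ + k ^ 2 * (F r θ * c θ)) = 0 := by
      rw [intervalIntegral.integral_eq_sub_of_hasDerivAt (f := fun θ => T1 θ * c θ - F r θ * c' θ)]
      · simp [T1, F, hp, hp']
      · intro θ _
        refine (((hT1 θ).mul (hc θ)).sub ((hFd θ).mul (hc' θ))).congr_deriv ?_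
        ring
      · apply Continuous.intervalIntegrable; fun_prop
    have hpt : ∀ θ, G1 r θ * c θ + r * (G2 r θ * c θ) =
        ((k:ℝ) ^ 2 / r - lam * r * rho r ^ 2) * (F r θ * c θ)
          - 1 / r * (T2 θ * c θ + k ^ 2 * (F r θ * c θ)) := by
      intro θ
      have hq := hmem r hr' θ
      have e := hf_eq _ hq
      rw [hlap _ hq] at e
      simp only [sqP] at e
      have e' : r * rho r ^ 2 * lam * F r θ = - r * (fuu (r * Real.cos θ, r * Real.sin θ) +
          fvv (r * Real.cos θ, r * Real.sin θ)) := by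
        rw [e]; simp only [rho, F]; ring
      have e3 : G1 r θ + r * G2 r θ = r * (fuu (r * Real.cos θ, r * Real.sin θ) +
          fvv (r * Real.cos θ, r * Real.sin θ)) - 1 / r * T2 θ := by
        simp only [G1, G2, T2]
        generalize fu (r * Real.cos θ, r * Real.sin θ) = a1
        generalize fv (r * Real.cos θ, r * Real.sin θ) = a2
        generalize fuu (r * Real.cos θ, r * Real.sin θ) = a3
        generalize fuv (r * Real.cos θ, r * Real.sin θ) = a4
        generalize fvu (r * Real.cos θ, r * Real.sin θ) = a5
        generalize fvv (r * Real.cos θ, r * Real.sin θ) = a6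
        field_simp
        linear_combination r * (a3 + a6) * Real.sin_sq_add_cos_sq θ
      linear_combination c θ * e3 + c θ * e'
    have cG1 : Continuous (G1 r) := gen3 _ _ k1 k2
    have cG2 : Continuous (G2 r) := gen3 _ _ (gen3 _ _ k3 k4) (gen3 _ _ k5 k6)
    calc 1 * ψ r + r * ∫ θ in (0:ℝ)..(2 * Real.pi), G2 r θ * c θ
        = ∫ θ in (0:ℝ)..(2 * Real.pi), (G1 r θ * c θ + r * (G2 r θ * c θ)) := by
          rw [intervalIntegral.integral_add, intervalIntegral.integral_const_mul, one_mul]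
          · apply Continuous.intervalIntegrable; fun_prop
          · apply Continuous.intervalIntegrable; fun_prop
      _ = _ := by
          simp_rw [hpt]
          rw [intervalIntegral.integral_sub, intervalIntegral.integral_const_mul,
            intervalIntegral.integral_const_mul, ibp, mul_zero, sub_zero]
          · apply Continuous.intervalIntegrable; fun_prop
          · apply Continuous.intervalIntegrable; fun_prop
  have hd : ∀ r ∈ Ioo (0:ℝ) 2, HasDerivAt φ (ψ r) r := fun r hr =>
    hφd r ⟨by linarith [hr.1], hr.2⟩
  exact radial_zero k φ hφc (poly_zero k φ hφc
    (moments_zero k lam φ ψ hφc hφ2 hψc hd hd2 hlam))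

theorem stmt15 (lam : ℝ) (f : ℝ × ℝ → ℝ)
    (hf_cont : ContinuousOn f {q : ℝ × ℝ | q.1 ^ 2 + q.2 ^ 2 ≤ 4})
    (hf_smooth : ContDiffOn ℝ 2 f {q : ℝ × ℝ | q.1 ^ 2 + q.2 ^ 2 < 4})
    (hf_bdry : ∀ q : ℝ × ℝ, q.1 ^ 2 + q.2 ^ 2 = 4 → f q = 0)
    (hf_ne : ∃ q : ℝ × ℝ, q.1 ^ 2 + q.2 ^ 2 < 4 ∧ f q ≠ 0)
    (hf_eq : ∀ q : ℝ × ℝ, q.1 ^ 2 + q.2 ^ 2 < 4 →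
      lap2 f q = -lam * (4 / (q.1 ^ 2 + q.2 ^ 2 + 4)) ^ 2 * f q) :
    ∃ n : ℕ, 1 ≤ n ∧ lam = (n : ℝ) * (n + 1) := by
  by_contra hcon
  have hlam : ∀ n : ℕ, 1 ≤ n → lam ≠ (n : ℝ) * (n + 1) := fun n hn h => hcon ⟨n, hn, h⟩
  have sqP : ∀ r θ : ℝ, (r * Real.cos θ) ^ 2 + (r * Real.sin θ) ^ 2 = r ^ 2 := fun r θ => by
    linear_combination r ^ 2 * Real.sin_sq_add_cos_sq θ
  have hlin : ∀ (k : ℕ) (θ : ℝ), HasDerivAt (fun θ : ℝ => (k:ℝ) * θ) (k:ℝ) θ := fun k θ => by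
    simpa using (hasDerivAt_id θ).const_mul (k:ℝ)
  have hper : ∀ k : ℕ, Real.cos (k * (2 * Real.pi)) = 1 := fun k => Real.cos_nat_mul_two_pi k
  have hper' : ∀ k : ℕ, Real.sin (k * (2 * Real.pi)) = 0 := fun k => by
    have := Real.sin_nat_mul_pi (k * 2)
    rw [← this]; push_cast; ring_nf
  have hpos : ∀ r ∈ Ioo (0:ℝ) 2, ∀ θ : ℝ, f (r * Real.cos θ, r * Real.sin θ) = 0 := by
    intro r hr θ
    refine aux_fourier (fun θ => f (r * Real.cos θ, r * Real.sin θ)) ?_ ?_ ?_ ?_ θ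
    · refine hf_cont.comp_continuous (by fun_prop) (fun θ => ?_)
      simp only [mem_ofPred_eq, sqP]
      nlinarith [hr.1, hr.2]
    · intro x; simp
    · intro k
      refine mode_zero lam f hf_cont hf_smooth hf_bdry hf_eq hlam k (fun θ => Real.cos (k * θ))
        (fun θ => -Real.sin (k * θ) * k) (fun θ => (hlin k θ).cos) (fun θ => ?_) ?_ ?_ r hr
      · refine ((hlin k θ).sin.neg.mul_const (k:ℝ)).congr_deriv ?_
        ring
      · simp [hper]
      · simp [hper']
    · intro k
      refine mode_zero lam f hf_cont hf_smooth hf_bdry hf_eq hlam k (fun θ => Real.sin (k * θ))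
        (fun θ => Real.cos (k * θ) * k) (fun θ => (hlin k θ).sin) (fun θ => ?_) ?_ ?_ r hr
      · refine ((hlin k θ).cos.mul_const (k:ℝ)).congr_deriv ?_
        ring
      · simp [hper']
      · simp [hper]
  -- the origin
  have hzero : f (0, 0) = 0 := by
    have hc : ContinuousAt (fun r : ℝ => f (r, 0)) 0 := by
      have h1 : ContinuousAt f (0, 0) := hf_cont.continuousAt
        (mem_of_superset ((isOpen_lt (f := fun q : ℝ × ℝ => q.1 ^ 2 + q.2 ^ 2) (g := fun _ => (4:ℝ))
          (by fun_prop) (by fun_prop)).mem_nhds (by simp)) (fun q hq => by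
            rw [mem_ofPred_eq] at hq ⊢; exact le_of_lt hq))
      exact ContinuousAt.comp (f := fun r : ℝ => (r, (0:ℝ))) (x := 0) h1 (by fun_prop)
    have h2 : Tendsto (fun r : ℝ => f (r, 0)) (𝓝[>] 0) (𝓝 (f (0, 0))) :=
      hc.tendsto.mono_left nhdsWithin_le_nhds
    have h3 : Tendsto (fun r : ℝ => f (r, 0)) (𝓝[>] 0) (𝓝 0) := by
      refine tendsto_const_nhds.congr' ?_
      filter_upwards [Ioo_mem_nhdsGT (show (0:ℝ) < 2 by norm_num)] with r hr
      have := hpos r hr 0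
      simpa using this.symm
    exact tendsto_nhds_unique h2 h3
  obtain ⟨q, hq, hne⟩ := hf_ne
  apply hne
  have hn : ‖(⟨q.1, q.2⟩ : ℂ)‖ ^ 2 = q.1 ^ 2 + q.2 ^ 2 := by
    rw [Complex.sq_norm, Complex.normSq_mk]; ring
  have e1 := Complex.norm_mul_cos_arg ⟨q.1, q.2⟩
  have e2 := Complex.norm_mul_sin_arg ⟨q.1, q.2⟩
  simp only at e1 e2
  rcases (norm_nonneg (⟨q.1, q.2⟩ : ℂ)).eq_or_lt with h0 | h0
  · have hq0 : q = (0, 0) := by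
      rw [← h0] at e1 e2
      ext <;> simp <;> linarith
    rw [hq0, hzero]
  · have := hpos ‖(⟨q.1, q.2⟩ : ℂ)‖ ⟨h0, by nlinarith⟩ (Complex.arg ⟨q.1, q.2⟩)
    rwa [e1, e2] at this
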